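/- arXiv:2604.18882 — 4 statements merged into one kernel-verified Lean document; each statement's English description precedes it below -/
import Mathlib

section
/- Pointwise monotonicity of effective scores: suppose 0 ≤ β₁ v ≤ β₂ v for every v, and eff₁, eff₂ : V → ℚ satisfy the threshold recursions with respect to β₁ and β₂ respectively (same deps and same θ), over an acyclic dependency structure. Then eff₁ v ≤ eff₂ v for every v. -/
/-- Pointwise monotonicity of effective scores. -/
theorem eff_pointwise_monotone {V : Type*} [Fintype V]
    (deps : V → Finset V) (d : V → ℕ)
    (hd : ∀ v, ∀ u ∈ deps v, d u < d v)
    (β₁ β₂ : V → ℚ)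
    (hβ0 : ∀ v, 0 ≤ β₁ v) (hβ : ∀ v, β₁ v ≤ β₂ v)
    (θ : ℚ)
    (eff₁ eff₂ : V → ℚ)
    (h₁a : ∀ v, (∀ u ∈ deps v, θ ≤ eff₁ u) → eff₁ v = β₁ v)
    (h₁b : ∀ v, ¬ (∀ u ∈ deps v, θ ≤ eff₁ u) → eff₁ v = 0)
    (h₂a : ∀ v, (∀ u ∈ deps v, θ ≤ eff₂ u) → eff₂ v = β₂ v)
    (h₂b : ∀ v, ¬ (∀ u ∈ deps v, θ ≤ eff₂ u) → eff₂ v = 0) :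
    ∀ v : V, eff₁ v ≤ eff₂ v := by
  intro v
  induction v using (measure d).wf.induction with
  | _ v ih =>
    have ih' : ∀ u ∈ deps v, eff₁ u ≤ eff₂ u := fun u hu => ih u (hd v u hu)
    by_cases h₁ : ∀ u ∈ deps v, θ ≤ eff₁ u
    · have h₂ : ∀ u ∈ deps v, θ ≤ eff₂ u := fun u hu => (h₁ u hu).trans (ih' u hu)
      rw [h₁a v h₁, h₂a v h₂]
      exact hβ v
    · rw [h₁b v h₁]
      by_cases h₂ : ∀ u ∈ deps v, θ ≤ eff₂ u
      · rw [h₂a v h₂]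
        exact (hβ0 v).trans (hβ v)
      · rw [h₂b v h₂]
end

section
/- Monotonicity of weighted coverage: under the hypotheses of pointwise monotonicity of effective scores (0 ≤ β₁ ≤ β₂ pointwise, eff₁ and eff₂ the corresponding threshold-recursion solutions) and with strictly positive weights w : V → ℚ on a finite nonempty V, the weighted coverages satisfy ((∑ v, w v * eff₁ v) / (∑ v, w v)) * 100 ≤ ((∑ v, w v * eff₂ v) / (∑ v, w v)) * 100. -/
/-- Solutions of the threshold recursion on a well-founded dependency relation are pointwise
monotone in nonnegative base scores. -/
theorem threshold_recursion_mono {V : Type*} {deps : V → Finset V} {d : V → ℕ}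
    (hd : ∀ v, ∀ u ∈ deps v, d u < d v)
    {β₁ β₂ : V → ℚ} (hβ0 : ∀ v, 0 ≤ β₁ v) (hβ : ∀ v, β₁ v ≤ β₂ v)
    {θ : ℚ} {eff₁ eff₂ : V → ℚ}
    (h₁a : ∀ v, (∀ u ∈ deps v, θ ≤ eff₁ u) → eff₁ v = β₁ v)
    (h₁b : ∀ v, ¬ (∀ u ∈ deps v, θ ≤ eff₁ u) → eff₁ v = 0)
    (h₂a : ∀ v, (∀ u ∈ deps v, θ ≤ eff₂ u) → eff₂ v = β₂ v)
    (h₂b : ∀ v, ¬ (∀ u ∈ deps v, θ ≤ eff₂ u) → eff₂ v = 0) (v : V) :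
    eff₁ v ≤ eff₂ v := by
  induction v using (measure d).wf.induction with
  | _ v ih =>
    by_cases h₁ : ∀ u ∈ deps v, θ ≤ eff₁ u
    · have h₂ : ∀ u ∈ deps v, θ ≤ eff₂ u := fun u hu => (h₁ u hu).trans (ih u (hd v u hu))
      rw [h₁a v h₁, h₂a v h₂]
      exact hβ v
    · rw [h₁b v h₁]
      by_cases h₂ : ∀ u ∈ deps v, θ ≤ eff₂ u
      · rw [h₂a v h₂]
        exact (hβ0 v).trans (hβ v)
      · rw [h₂b v h₂]


/-- Monotonicity of weighted coverage under pointwise score improvement. -/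
theorem coverage_monotone {V : Type*} [Fintype V] [Nonempty V]
    (deps : V → Finset V) (d : V → ℕ)
    (hd : ∀ v, ∀ u ∈ deps v, d u < d v)
    (w : V → ℚ) (hw : ∀ v, 0 < w v)
    (β₁ β₂ : V → ℚ)
    (hβ0 : ∀ v, 0 ≤ β₁ v) (hβ : ∀ v, β₁ v ≤ β₂ v)
    (θ : ℚ)
    (eff₁ eff₂ : V → ℚ)
    (h₁a : ∀ v, (∀ u ∈ deps v, θ ≤ eff₁ u) → eff₁ v = β₁ v)
    (h₁b : ∀ v, ¬ (∀ u ∈ deps v, θ ≤ eff₁ u) → eff₁ v = 0)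
    (h₂a : ∀ v, (∀ u ∈ deps v, θ ≤ eff₂ u) → eff₂ v = β₂ v)
    (h₂b : ∀ v, ¬ (∀ u ∈ deps v, θ ≤ eff₂ u) → eff₂ v = 0) :
    ((∑ v, w v * eff₁ v) / (∑ v, w v)) * 100 ≤
      ((∑ v, w v * eff₂ v) / (∑ v, w v)) * 100 := by
  have hsum : 0 ≤ ∑ v, w v := Finset.sum_nonneg fun v _ => (hw v).le
  have hle : ∑ v, w v * eff₁ v ≤ ∑ v, w v * eff₂ v :=
    Finset.sum_le_sum fun v _ => mul_le_mul_of_nonneg_left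
      (threshold_recursion_mono hd hβ0 hβ h₁a h₁b h₂a h₂b v) (hw v).le
  exact mul_le_mul_of_nonneg_right (div_le_div_of_nonneg_right hle hsum) (by norm_num)
end

section
/- Construction-sensitivity sandwich: let W : (V → ℚ) → ℚ be the weighted-coverage function (the weighted average, times 100, of the threshold-recursion effective scores) and let c : ℚ be a coverage-satisfaction threshold. Suppose 0 ≤ β₂ v ≤ β' v ≤ β₁ v ≤ 1 pointwise. If the satisfaction outcomes at the endpoints agree, i.e., (c ≤ W β₁ ↔ c ≤ W β₂), then the intermediate outcome agrees as well: c ≤ W β' ↔ c ≤ W β₁. -/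
/-- Threshold-recursion effective scores are monotone in the score function. -/
theorem effectiveScore_mono {V : Type*} (deps : V → Finset V) (d : V → ℕ)
    (hd : ∀ v, ∀ u ∈ deps v, d u < d v) (θ : ℚ) (β γ : V → ℚ)
    (hβγ : ∀ v, β v ≤ γ v) (hγ : ∀ v, 0 ≤ γ v) (e f : V → ℚ)
    (he : ∀ v, (∀ u ∈ deps v, θ ≤ e u) → e v = β v)
    (he₀ : ∀ v, ¬ (∀ u ∈ deps v, θ ≤ e u) → e v = 0)
    (hf : ∀ v, (∀ u ∈ deps v, θ ≤ f u) → f v = γ v)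
    (hf₀ : ∀ v, ¬ (∀ u ∈ deps v, θ ≤ f u) → f v = 0) (v : V) : e v ≤ f v := by
  induction v using (measure d).wf.induction with
  | _ v ih =>
    by_cases h : ∀ u ∈ deps v, θ ≤ e u
    · rw [he v h, hf v fun u hu => (h u hu).trans (ih u (hd v u hu))]
      exact hβγ v
    · rw [he₀ v h]
      by_cases hfv : ∀ u ∈ deps v, θ ≤ f u
      · rw [hf v hfv]
        exact hγ v
      · rw [hf₀ v hfv]

/-- Weighted coverage is monotone in the effective scores. -/
theorem weightedCoverage_mono {V : Type*} [Fintype V] (w : V → ℚ) (hw : ∀ v, 0 ≤ w v)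
    {e f : V → ℚ} (hef : ∀ v, e v ≤ f v) :
    ((∑ v, w v * e v) / (∑ v, w v)) * 100 ≤ ((∑ v, w v * f v) / (∑ v, w v)) * 100 := by
  have hsum : 0 ≤ ∑ v, w v := Finset.sum_nonneg fun v _ => hw v
  have hle : ∑ v, w v * e v ≤ ∑ v, w v * f v :=
    Finset.sum_le_sum fun v _ => mul_le_mul_of_nonneg_left (hef v) (hw v)
  gcongr


/-- Construction-sensitivity sandwich: if the satisfaction outcomes
agree at the two endpoint score functions (`β₁` broad, `β₂` narrow), then any
intermediate score function `β'` yields the same satisfaction outcome. -/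
theorem construction_sensitivity_sandwich {V : Type*} [Fintype V] [Nonempty V]
    (deps : V → Finset V) (d : V → ℕ)
    (hd : ∀ v, ∀ u ∈ deps v, d u < d v)
    (w : V → ℚ) (hw : ∀ v, 0 < w v)
    (θ c : ℚ)
    (β₁ β' β₂ : V → ℚ)
    (hβ : ∀ v, 0 ≤ β₂ v ∧ β₂ v ≤ β' v ∧ β' v ≤ β₁ v ∧ β₁ v ≤ 1)
    (eff₁ eff' eff₂ : V → ℚ)
    (h₁a : ∀ v, (∀ u ∈ deps v, θ ≤ eff₁ u) → eff₁ v = β₁ v)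
    (h₁b : ∀ v, ¬ (∀ u ∈ deps v, θ ≤ eff₁ u) → eff₁ v = 0)
    (h'a : ∀ v, (∀ u ∈ deps v, θ ≤ eff' u) → eff' v = β' v)
    (h'b : ∀ v, ¬ (∀ u ∈ deps v, θ ≤ eff' u) → eff' v = 0)
    (h₂a : ∀ v, (∀ u ∈ deps v, θ ≤ eff₂ u) → eff₂ v = β₂ v)
    (h₂b : ∀ v, ¬ (∀ u ∈ deps v, θ ≤ eff₂ u) → eff₂ v = 0)
    (hends : c ≤ ((∑ v, w v * eff₁ v) / (∑ v, w v)) * 100 ↔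
             c ≤ ((∑ v, w v * eff₂ v) / (∑ v, w v)) * 100) :
    (c ≤ ((∑ v, w v * eff' v) / (∑ v, w v)) * 100 ↔
     c ≤ ((∑ v, w v * eff₁ v) / (∑ v, w v)) * 100) := by
  have hlow := weightedCoverage_mono w (fun v => (hw v).le)
    (effectiveScore_mono deps d hd θ β₂ β' (fun v => (hβ v).2.1)
      (fun v => (hβ v).1.trans (hβ v).2.1) eff₂ eff' h₂a h₂b h'a h'b)
  have hhigh := weightedCoverage_mono w (fun v => (hw v).le)
    (effectiveScore_mono deps d hd θ β' β₁ (fun v => (hβ v).2.2.1)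
      (fun v => (hβ v).1.trans ((hβ v).2.1.trans (hβ v).2.2.1)) eff' eff₁ h'a h'b h₁a h₁b)
  exact ⟨fun h => h.trans hhigh, fun h => (hends.mp h).trans hlow⟩
end

section
/- The threshold effective score is the least prefixed point of F: let eff : V → ℚ be the unique solution of the threshold recursion over an acyclic dependency structure, with 0 ≤ β v for all v. Then for every e : V → ℚ with 0 ≤ e v for all v and F e v ≤ e v for every v (a prefixed point of the monotone propagation function F), one has eff v ≤ e v for every v. -/
/-- The propagation function `F e v = β v` if all dependencies of `v` meet
threshold `θ` under `e`, else `0`. -/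
def propF {V : Type*} (deps : V → Finset V) (β : V → ℚ) (θ : ℚ)
    (e : V → ℚ) (v : V) : ℚ :=
  if ∀ u ∈ deps v, θ ≤ e u then β v else 0

/-- The threshold effective score is the least (nonnegative)
prefixed point of the monotone propagation function `F`. -/
theorem eff_least_prefixed_point {V : Type*} [Fintype V]
    (deps : V → Finset V) (d : V → ℕ)
    (hd : ∀ v, ∀ u ∈ deps v, d u < d v)
    (β : V → ℚ) (hβ : ∀ v, 0 ≤ β v)
    (θ : ℚ)
    (eff : V → ℚ)
    (heff1 : ∀ v, (∀ u ∈ deps v, θ ≤ eff u) → eff v = β v)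
    (heff2 : ∀ v, ¬ (∀ u ∈ deps v, θ ≤ eff u) → eff v = 0) :
    ∀ e : V → ℚ, (∀ v, 0 ≤ e v) → (∀ v, propF deps β θ e v ≤ e v) →
      ∀ v, eff v ≤ e v := by
  intro e he hF v
  induction v using (measure d).wf.induction with
  | _ v ih =>
    by_cases h : ∀ u ∈ deps v, θ ≤ eff u
    · have hdeps : ∀ u ∈ deps v, θ ≤ e u := fun u hu => (h u hu).trans (ih u (hd v u hu))
      have hv := hF v
      rw [propF, if_pos hdeps] at hv
      exact (heff1 v h).trans_le hv
    · exact (heff2 v h).trans_le (he v)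
end
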